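/- Let P and Q be nonzero integers with D = P^2 - 4Q ≠ 0 and let U = U(P,Q) be nondegenerate. Let n > 1 have at least two distinct prime factors, with gcd(n, gcd(P,Q)) = 1, and let p be the largest prime dividing n; write ∂_p(n) = n / p^{v_p(n)} for the p-free part of n. Exclude the case where P and Q are both odd and ∂_2(n) = 3 (i.e. n = 2^k·3). Then: if ∂_p(n) is the entry point of p in U (i.e. p ∣ U_{∂_p(n)} and p ∤ U_m for all 1 ≤ m < ∂_p(n)), there exists an integer t with M^U_n = (D/p)·p + n·t; otherwise there exists an integer t with M^U_n = 1 + n·t. Here (D/p) is the Legendre symbol (p is odd, being the largest of at least two prime factors). -/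

import Mathlib

/-- Lucas sequence of the first kind: `U 0 = 0`, `U 1 = 1`,
`U (n+2) = P * U (n+1) - Q * U n`. -/
def lucasU (P Q : ℤ) : ℕ → ℤ
  | 0 => 0
  | 1 => 1
  | n + 2 => P * lucasU P Q (n + 1) - Q * lucasU P Q n

/-- Möbius dual of the Lucas sequence of the first kind:
`M^U_n = ∏_{d ∣ n} U_d ^ μ(n/d)`, as a rational number. -/
def mobiusDualU (P Q : ℤ) (n : ℕ) : ℚ :=
  ∏ d ∈ n.divisors, (lucasU P Q d : ℚ) ^ (ArithmeticFunction.moebius (n / d))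

open MvPolynomial in
theorem symm_exists (F : MvPolynomial (Fin 2) ℤ) (hF : F.IsSymmetric) :
    ∃ G : MvPolynomial (Fin 2) ℤ, ∀ (A : Type) [CommRing A] (a b : A),
      aeval ![a + b, a * b] G = aeval ![a, b] F := by
  obtain ⟨G, hG⟩ := esymmAlgHom_surjective (σ := Fin 2) (R := ℤ) (n := 2) (by simp) ⟨F, hF⟩
  refine ⟨G, fun A _ a b => ?_⟩
  have h1 : aeval (fun i : Fin 2 ↦ esymm (Fin 2) ℤ (i + 1)) G = F := by
    rw [← esymmAlgHom_apply, hG]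
  have e1 : esymm (Fin 2) ℤ 1 = X 0 + X 1 := by
    rw [esymm_one]; simp [Fin.sum_univ_two]
  have e2 : esymm (Fin 2) ℤ 2 = X 0 * X 1 := by
    have : Finset.powersetCard 2 (Finset.univ : Finset (Fin 2)) = {Finset.univ} := by decide
    rw [esymm, this]; simp [Fin.prod_univ_two]
  conv_rhs => rw [← h1]
  rw [← AlgHom.comp_apply, comp_aeval]
  congr 2
  funext i
  fin_cases i
  · simp [e1]
  · simp [e2]

/-- Homogenised cyclotomic polynomial. -/
noncomputable def homCyc (n : ℕ) : MvPolynomial (Fin 2) ℤ :=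
  (Polynomial.cyclotomic n ℤ).homogenize n.totient

theorem homCyc_prod (n : ℕ) (hn : 0 < n) :
    ∏ d ∈ n.divisors, homCyc d = MvPolynomial.X 0 ^ n - MvPolynomial.X 1 ^ n := by
  unfold homCyc
  rw [← Polynomial.homogenize_finsetProd, Polynomial.prod_cyclotomic_eq_X_pow_sub_one hn,
    Nat.sum_totient, Polynomial.homogenize_sub, Polynomial.homogenize_X_pow le_rfl,
    Polynomial.homogenize_one]
  · simp
  · intro d hd
    rw [Polynomial.natDegree_cyclotomic]

theorem homCyc_ne_zero (n : ℕ) : homCyc n ≠ 0 := by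
  unfold homCyc
  rw [Ne, Polynomial.homogenize_eq_zero_iff]
  · exact Polynomial.cyclotomic_ne_zero n ℤ
  · rw [Polynomial.natDegree_cyclotomic]

theorem homCyc_one : homCyc 1 = MvPolynomial.X 0 - MvPolynomial.X 1 := by
  have := homCyc_prod 1 one_pos
  simpa using this

theorem homCyc_swap (n : ℕ) (hn : 2 ≤ n) :
    MvPolynomial.rename (Equiv.swap (0 : Fin 2) 1) (homCyc n) = homCyc n := by
  induction n using Nat.strong_induction_on with
  | _ n ih =>
  have h1 := homCyc_prod n (by omega)
  have h2 := congrArg (MvPolynomial.rename (Equiv.swap (0 : Fin 2) 1)) h1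
  rw [map_prod] at h2
  simp only [map_sub, map_pow, MvPolynomial.rename_X, Equiv.swap_apply_left,
    Equiv.swap_apply_right] at h2
  rw [← Nat.cons_self_properDivisors (by omega), Finset.prod_cons] at h1 h2
  have hmem : 1 ∈ n.properDivisors := by
    rw [Nat.mem_properDivisors]; exact ⟨one_dvd _, by omega⟩
  rw [← Finset.mul_prod_erase _ _ hmem] at h1 h2
  have h3 : ∏ x ∈ n.properDivisors.erase 1,
      MvPolynomial.rename (Equiv.swap (0 : Fin 2) 1) (homCyc x)
      = ∏ x ∈ n.properDivisors.erase 1, homCyc x := by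
    apply Finset.prod_congr rfl
    intro x hx
    rw [Finset.mem_erase, Nat.mem_properDivisors] at hx
    apply ih x hx.2.2
    have : x ≠ 0 := by rintro rfl; have := hx.2.1; simp at this; omega
    omega
  rw [h3, homCyc_one] at h2
  rw [homCyc_one] at h1
  simp only [map_sub, MvPolynomial.rename_X, Equiv.swap_apply_left,
    Equiv.swap_apply_right] at h2
  have h4 : ∏ x ∈ n.properDivisors.erase 1, homCyc x ≠ 0 :=
    Finset.prod_ne_zero_iff.2 fun x _ => homCyc_ne_zero x
  have h5 := homCyc_ne_zero 1
  rw [homCyc_one] at h5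
  apply mul_right_cancel₀ (mul_ne_zero h5 h4)
  linear_combination -h2 - h1

theorem isSymmetric_fin_two (F : MvPolynomial (Fin 2) ℤ)
    (h : MvPolynomial.rename (Equiv.swap (0 : Fin 2) 1) F = F) : F.IsSymmetric := by
  intro e
  have : e = 1 ∨ e = Equiv.swap (0 : Fin 2) 1 := by
    revert e; decide
  rcases this with rfl | rfl
  · simp
  · exact h

theorem exists_T (n : ℕ) : ∃ G : MvPolynomial (Fin 2) ℤ, 2 ≤ n →
    ∀ (A : Type) [CommRing A] (a b : A),
      MvPolynomial.aeval ![a + b, a * b] G = MvPolynomial.aeval ![a, b] (homCyc n) := by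
  by_cases hn : 2 ≤ n
  · obtain ⟨G, hG⟩ := symm_exists _ (isSymmetric_fin_two _ (homCyc_swap n hn))
    exact ⟨G, fun _ => hG⟩
  · exact ⟨0, fun h => absurd h hn⟩

/-- Cyclotomic factors of the Lucas sequence. -/
noncomputable def Tv (n : ℕ) (P Q : ℤ) : ℤ :=
  if 2 ≤ n then MvPolynomial.aeval ![P, Q] (exists_T n).choose else 1

theorem aeval_vec_cast (A : Type) [CommRing A] (P Q : ℤ) (G : MvPolynomial (Fin 2) ℤ) :
    ((MvPolynomial.aeval ![P, Q] G : ℤ) : A) = MvPolynomial.aeval ![(P : A), (Q : A)] G := by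
  have := MvPolynomial.map_aeval ![P, Q] (Int.castRingHom A) G
  simp only [eq_intCast] at this
  rw [this, MvPolynomial.aeval_def, MvPolynomial.coe_eval₂Hom]
  congr 1
  funext i; fin_cases i <;> simp

theorem aeval_vec_congr (N : ℕ) (P Q P' Q' : ℤ) (G : MvPolynomial (Fin 2) ℤ)
    (h1 : (N : ℤ) ∣ P - P') (h2 : (N : ℤ) ∣ Q - Q') :
    (N : ℤ) ∣ MvPolynomial.aeval ![P, Q] G - MvPolynomial.aeval ![P', Q'] G := by
  rw [← ZMod.intCast_zmod_eq_zero_iff_dvd, Int.cast_sub, sub_eq_zero] at *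
  rw [aeval_vec_cast, aeval_vec_cast, h1, h2]

theorem Tv_congr (n : ℕ) (N : ℕ) (P Q P' Q' : ℤ)
    (h1 : (N : ℤ) ∣ P - P') (h2 : (N : ℤ) ∣ Q - Q') :
    (N : ℤ) ∣ Tv n P Q - Tv n P' Q' := by
  unfold Tv
  split_ifs
  · exact aeval_vec_congr _ _ _ _ _ _ h1 h2
  · simp

theorem Tv_cast {n : ℕ} (hn : 2 ≤ n) {A : Type} [CommRing A] {P Q : ℤ} {a b : A}
    (h1 : a + b = P) (h2 : a * b = Q) :
    (Tv n P Q : A) = MvPolynomial.aeval ![a, b] (homCyc n) := by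
  rw [Tv, if_pos hn, aeval_vec_cast, ← h1, ← h2]
  exact (exists_T n).choose_spec hn A a b

theorem aeval_homCyc {K : Type} [Field K] (n : ℕ) (a b : K) (hb : b ≠ 0) :
    MvPolynomial.aeval ![a, b] (homCyc n)
      = b ^ n.totient * (Polynomial.cyclotomic n K).eval (a / b) := by
  have h := Polynomial.eval_homogenize (p := Polynomial.cyclotomic n K) (n := n.totient)
    (by rw [Polynomial.natDegree_cyclotomic]) ![a, b] (by simpa using hb)
  rw [← Polynomial.map_cyclotomic n (algebraMap ℤ K), Polynomial.homogenize_map,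
    MvPolynomial.eval_map, ← MvPolynomial.aeval_def] at h
  rw [homCyc, h]
  simp [mul_comm]

/-- Companion sequence. -/
def lucasV (P Q : ℤ) (k : ℕ) : ℤ := 2 * lucasU P Q (k + 1) - P * lucasU P Q k

theorem lucasU_cast {A : Type} [CommRing A] {P Q : ℤ} {a b : A}
    (h1 : a + b = P) (h2 : a * b = Q) (k : ℕ) :
    (lucasU P Q k : A) * (a - b) = a ^ k - b ^ k := by
  induction k using Nat.strong_induction_on with
  | _ k ih =>
  match k with
  | 0 => simp [lucasU]
  | 1 => simp [lucasU]
  | k + 2 =>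
    have e1 := ih (k + 1) (by omega)
    have e2 := ih k (by omega)
    rw [lucasU]; push_cast
    rw [← h1, ← h2]
    linear_combination (a + b) * e1 - a * b * e2

theorem lucasU_succ_cast {A : Type} [CommRing A] {P Q : ℤ} {a b : A}
    (h1 : a + b = P) (h2 : a * b = Q) (k : ℕ) :
    (lucasU P Q (k + 1) : A) = a * lucasU P Q k + b ^ k := by
  induction k using Nat.strong_induction_on with
  | _ k ih =>
  match k with
  | 0 => simp [lucasU]
  | 1 => simp [lucasU, ← h1]
  | k + 2 =>
    have e1 := ih (k + 1) (by omega)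
    rw [lucasU]; push_cast
    rw [← h1, ← h2]
    linear_combination b * e1

theorem lucasV_cast {A : Type} [CommRing A] {P Q : ℤ} {a b : A}
    (h1 : a + b = P) (h2 : a * b = Q) (k : ℕ) :
    (lucasV P Q k : A) = a ^ k + b ^ k := by
  have e1 := lucasU_succ_cast h1 h2 k
  have e2 := lucasU_succ_cast (a := b) (b := a) (by rw [← h1]; ring) (by rw [← h2]; ring) k
  rw [lucasV]; push_cast; rw [← h1]
  linear_combination e1 + e2

theorem exists_roots (K : Type) [Field K] [IsAlgClosed K] (P Q : ℤ) :
    ∃ a b : K, a + b = P ∧ a * b = Q := by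
  obtain ⟨a, ha⟩ := IsAlgClosed.exists_root
    (Polynomial.X ^ 2 - Polynomial.C (P : K) * Polynomial.X + Polynomial.C (Q : K))
    (by 
      have : (Polynomial.X ^ 2 - Polynomial.C (P : K) * Polynomial.X + Polynomial.C (Q : K)).degree = 2 := by
        compute_degree!
      rw [this]; decide)
  simp [Polynomial.IsRoot] at ha
  exact ⟨a, P - a, by ring, by linear_combination -ha⟩

theorem lucasV_lucasU_sq (P Q : ℤ) (k : ℕ) :
    lucasV P Q k ^ 2 - 4 * Q ^ k = (P ^ 2 - 4 * Q) * lucasU P Q k ^ 2 := by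
  obtain ⟨a, b, h1, h2⟩ := exists_roots ℂ P Q
  have e1 := lucasU_cast h1 h2 k
  have e2 := lucasV_cast h1 h2 k
  have : ((lucasV P Q k ^ 2 - 4 * Q ^ k : ℤ) : ℂ)
      = (((P ^ 2 - 4 * Q) * lucasU P Q k ^ 2 : ℤ) : ℂ) := by
    push_cast
    rw [e2, ← h1, ← h2, mul_pow]
    linear_combination (-(lucasU P Q k : ℂ) * (a - b) - (a ^ k - b ^ k)) * e1
  exact_mod_cast this

theorem sub_ne_zero_of_disc {K : Type} [Field K] {P Q : ℤ} {a b : K}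
    (h1 : a + b = P) (h2 : a * b = Q) (hD : ((P ^ 2 - 4 * Q : ℤ) : K) ≠ 0) : a - b ≠ 0 := by
  intro h
  apply hD
  push_cast
  rw [← h1, ← h2]
  linear_combination (a - b) * h

theorem lucasU_mul (P Q : ℤ) (hD : P ^ 2 - 4 * Q ≠ 0) (j k : ℕ) :
    lucasU P Q (k * j) = lucasU P Q k * lucasU (lucasV P Q k) (Q ^ k) j := by
  obtain ⟨a, b, h1, h2⟩ := exists_roots ℂ P Q
  have hab := sub_ne_zero_of_disc h1 h2 (by exact_mod_cast hD)
  have e1 := lucasU_cast h1 h2 k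
  have e2 := lucasU_cast h1 h2 (k * j)
  have e3 := lucasU_cast (P := lucasV P Q k) (Q := Q ^ k) (lucasV_cast h1 h2 k).symm
    (by push_cast; rw [← h2, mul_pow]) j
  have : (lucasU P Q (k * j) : ℂ) = (lucasU P Q k : ℂ) * lucasU (lucasV P Q k) (Q ^ k) j := by
    apply mul_right_cancel₀ hab
    rw [← pow_mul, ← pow_mul] at e3
    linear_combination e2 - e3 - (lucasU (lucasV P Q k) (Q ^ k) j : ℂ) * e1
  exact_mod_cast this

theorem lucasV_mul (P Q : ℤ) (j k : ℕ) :
    lucasV P Q (k * j) = lucasV (lucasV P Q k) (Q ^ k) j := by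
  obtain ⟨a, b, h1, h2⟩ := exists_roots ℂ P Q
  have e2 := lucasV_cast h1 h2 (k * j)
  have e3 := lucasV_cast (P := lucasV P Q k) (Q := Q ^ k) (lucasV_cast h1 h2 k).symm
    (by push_cast; rw [← h2, mul_pow]) j
  have : (lucasV P Q (k * j) : ℂ) = lucasV (lucasV P Q k) (Q ^ k) j := by
    rw [e2, e3, pow_mul, pow_mul]
  exact_mod_cast this

theorem lucasV_prime (q : ℕ) (hq : q.Prime) : ∃ g : MvPolynomial (Fin 2) ℤ, ∀ s t : ℤ,
    lucasV s t q = s ^ q + q * MvPolynomial.aeval ![s, t] g := by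
  obtain ⟨r, hr⟩ := exists_add_pow_prime_eq hq
    (MvPolynomial.X 0 : MvPolynomial (Fin 2) ℤ) (MvPolynomial.X 1)
  have hsym : (MvPolynomial.X 0 * MvPolynomial.X 1 * r : MvPolynomial (Fin 2) ℤ).IsSymmetric := by
    apply isSymmetric_fin_two
    have h2 := congrArg (MvPolynomial.rename (Equiv.swap (0 : Fin 2) 1)) hr
    simp only [map_add, map_mul, map_pow, MvPolynomial.rename_X, Equiv.swap_apply_left,
      Equiv.swap_apply_right, map_natCast] at h2 ⊢
    have hq0 : (q : MvPolynomial (Fin 2) ℤ) ≠ 0 := by exact_mod_cast hq.ne_zero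
    apply mul_left_cancel₀ hq0
    linear_combination hr - h2
  obtain ⟨g, hg⟩ := symm_exists _ hsym
  refine ⟨-g, fun s t => ?_⟩
  obtain ⟨a, b, h1, h2⟩ := exists_roots ℂ s t
  have e1 := lucasV_cast h1 h2 q
  have e2 := hg ℂ a b
  have e3 := congrArg (MvPolynomial.aeval ![a, b]) hr
  simp only [map_add, map_mul, map_pow, MvPolynomial.aeval_X, map_natCast] at e3 e2
  simp only [Matrix.cons_val_zero, Matrix.cons_val_one] at e3 e2
  have : (lucasV s t q : ℂ) = s ^ q + q * ((MvPolynomial.aeval ![s, t] (-g) : ℤ) : ℂ) := by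
    rw [aeval_vec_cast, e1, ← h1, ← h2, map_neg, e2]
    linear_combination -e3
  exact_mod_cast this

theorem pow_prime_lift (q : ℕ) (hq : q.Prime) (c : ℕ) (s s' : ℤ)
    (h : (q : ℤ) ^ (c + 1) ∣ s - s') : (q : ℤ) ^ (c + 2) ∣ s ^ q - s' ^ q := by
  obtain ⟨y, hy⟩ := h
  obtain ⟨r, hr⟩ := exists_add_pow_prime_eq hq s' ((q : ℤ) ^ (c + 1) * y)
  have : s = s' + (q : ℤ) ^ (c + 1) * y := by linear_combination hy
  rw [this, hr]
  have h2 : (q : ℤ) ^ (c + 2) ∣ ((q : ℤ) ^ (c + 1) * y) ^ q := by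
    rw [mul_pow, ← pow_mul]
    apply Dvd.dvd.mul_right
    apply pow_dvd_pow
    have := hq.two_le
    nlinarith
  have h3 : (q : ℤ) ^ (c + 2) ∣ q * s' * ((q : ℤ) ^ (c + 1) * y) * r :=
    ⟨s' * y * r, by ring⟩
  have e : s' ^ q + ((q : ℤ) ^ (c + 1) * y) ^ q + q * s' * ((q : ℤ) ^ (c + 1) * y) * r - s' ^ q
    = ((q : ℤ) ^ (c + 1) * y) ^ q + q * s' * ((q : ℤ) ^ (c + 1) * y) * r := by ring
  rw [e]
  exact dvd_add h2 h3

theorem fermat_dvd (q : ℕ) (hq : q.Prime) (Q : ℤ) : (q : ℤ) ∣ Q ^ q - Q := by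
  have := Fact.mk hq
  rw [← ZMod.intCast_zmod_eq_zero_iff_dvd]
  push_cast
  rw [ZMod.pow_card, sub_self]

theorem gauss_Q (q : ℕ) (hq : q.Prime) (Q : ℤ) (c : ℕ) :
    (q : ℤ) ^ (c + 1) ∣ Q ^ (q ^ (c + 1)) - Q ^ (q ^ c) := by
  have := dvd_sub_pow_of_dvd_sub (fermat_dvd q hq Q) c
  rw [← pow_mul, ← pow_succ'] at this
  exact this

theorem gauss_V (q : ℕ) (hq : q.Prime) (P Q : ℤ) (c : ℕ) :
    (q : ℤ) ^ (c + 1) ∣ lucasV P Q (q ^ (c + 1)) - lucasV P Q (q ^ c) := by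
  obtain ⟨g, hg⟩ := lucasV_prime q hq
  induction c with
  | zero =>
    have h1 : lucasV P Q 1 = P := by simp [lucasV, lucasU]; ring
    simp only [zero_add, pow_one, pow_zero, h1]
    rw [hg]
    obtain ⟨y, hy⟩ := fermat_dvd q hq P
    exact ⟨y + MvPolynomial.aeval ![P, Q] g, by linear_combination hy⟩
  | succ c ih =>
    have e (k : ℕ) : lucasV P Q (q ^ (k + 1)) = (lucasV P Q (q ^ k)) ^ q
        + q * MvPolynomial.aeval ![lucasV P Q (q ^ k), Q ^ q ^ k] g := by
      rw [pow_succ, lucasV_mul, hg]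
    have h1 := pow_prime_lift q hq c _ _ ih
    have h2 := aeval_vec_congr (q ^ (c + 1)) _ _ _ _ g (by exact_mod_cast ih)
      (by exact_mod_cast gauss_Q q hq Q c)
    obtain ⟨y, hy⟩ := h1
    obtain ⟨z, hz⟩ := h2
    push_cast at hz
    exact ⟨y + z, by linear_combination hy + q * hz + e (c + 1) - e c⟩

theorem cyc_mul {K : Type} [Field K] (q : ℕ) (hq : q.Prime) (m : ℕ) (hm : ¬ q ∣ m) (c : ℕ)
    (x : K) :
    (Polynomial.cyclotomic (q ^ (c + 1) * m) K).eval x *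
      (Polynomial.cyclotomic m K).eval (x ^ q ^ c)
      = (Polynomial.cyclotomic m K).eval (x ^ q ^ (c + 1)) := by
  induction c generalizing x with
  | zero =>
    have := congrArg (Polynomial.eval x) (Polynomial.cyclotomic_expand_eq_cyclotomic_mul hq hm K)
    rw [Polynomial.expand_eval, Polynomial.eval_mul] at this
    simp [mul_comm q m, this]
  | succ c ih =>
    have := congrArg (Polynomial.eval x) (Polynomial.cyclotomic_expand_eq_cyclotomic hq
      (n := q ^ (c + 1) * m) (Dvd.dvd.mul_right (dvd_pow_self q (by omega)) m) K)
    rw [Polynomial.expand_eval] at this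
    have h2 := ih (x ^ q)
    rw [this, ← pow_mul, ← pow_mul, ← pow_succ', ← pow_succ'] at h2
    rw [← h2]
    congr 3
    ring

theorem Tv_mul (P Q : ℤ) (hQ : Q ≠ 0) (q : ℕ) (hq : q.Prime) (m : ℕ) (hm2 : 2 ≤ m)
    (hm : ¬ q ∣ m) (c : ℕ) :
    Tv (q ^ (c + 1) * m) P Q * Tv m (lucasV P Q (q ^ c)) (Q ^ q ^ c)
      = Tv m (lucasV P Q (q ^ (c + 1))) (Q ^ q ^ (c + 1)) := by
  obtain ⟨a, b, h1, h2⟩ := exists_roots ℂ P Q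
  have hb : b ≠ 0 := by
    rintro rfl
    apply hQ
    have : (Q : ℂ) = 0 := by rw [← h2, mul_zero]
    exact_mod_cast this
  have hn : 2 ≤ q ^ (c + 1) * m :=
    le_trans hm2 (Nat.le_mul_of_pos_left _ (pow_pos hq.pos _))
  have e1 := Tv_cast hn h1 h2
  have e2 (k : ℕ) := Tv_cast (P := lucasV P Q k) (Q := Q ^ k) hm2 (lucasV_cast h1 h2 k).symm
    (by push_cast; rw [← h2, mul_pow])
  have : (Tv (q ^ (c + 1) * m) P Q : ℂ) * Tv m (lucasV P Q (q ^ c)) (Q ^ q ^ c)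
      = Tv m (lucasV P Q (q ^ (c + 1))) (Q ^ q ^ (c + 1)) := by
    rw [e1, e2, e2, aeval_homCyc _ _ _ hb, aeval_homCyc _ _ _ (pow_ne_zero _ hb),
      aeval_homCyc _ _ _ (pow_ne_zero _ hb), ← div_pow, ← div_pow, ← cyc_mul q hq m hm c]
    have ht : (q ^ (c + 1) * m).totient + q ^ c * m.totient = q ^ (c + 1) * m.totient := by
      rw [Nat.totient_mul, Nat.totient_prime_pow_succ hq, ← add_mul]
      · congr 1
        obtain ⟨r, rfl⟩ : ∃ r, q = r + 1 := ⟨q - 1, by have := hq.pos; omega⟩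
        simp; ring
      · exact Nat.Coprime.pow_left _ ((Nat.Prime.coprime_iff_not_dvd hq).2 hm)
    rw [← pow_mul, ← pow_mul, ← ht, pow_add]
    ring
  exact_mod_cast this

theorem Tv_prod (P Q : ℤ) (hD : P ^ 2 - 4 * Q ≠ 0) (n : ℕ) (hn : 0 < n) :
    ∏ d ∈ n.divisors, Tv d P Q = lucasU P Q n := by
  obtain ⟨a, b, h1, h2⟩ := exists_roots ℂ P Q
  have hab := sub_ne_zero_of_disc h1 h2 (by exact_mod_cast hD)
  have e1 := lucasU_cast h1 h2 n
  have e2 := congrArg (MvPolynomial.aeval ![a, b]) (homCyc_prod n hn)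
  have hmem : 1 ∈ n.divisors := by simp; omega
  rw [← Finset.mul_prod_erase _ _ hmem, homCyc_one] at e2
  simp only [map_sub, map_mul, map_pow, MvPolynomial.aeval_X, Matrix.cons_val_zero,
    Matrix.cons_val_one, map_prod] at e2
  rw [← Finset.mul_prod_erase _ _ hmem]
  have e3 : ∏ x ∈ n.divisors.erase 1, MvPolynomial.aeval ![a, b] (homCyc x)
      = ∏ x ∈ n.divisors.erase 1, (Tv x P Q : ℂ) := by
    apply Finset.prod_congr rfl
    intro x hx
    rw [Finset.mem_erase] at hx
    have := Nat.pos_of_mem_divisors hx.2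
    rw [Tv_cast (by omega) h1 h2]
  have : ((Tv 1 P Q * ∏ x ∈ n.divisors.erase 1, Tv x P Q : ℤ) : ℂ) = lucasU P Q n := by
    push_cast
    apply mul_right_cancel₀ hab
    rw [e1, ← e2, e3]
    simp [Tv]; ring
  exact_mod_cast this

theorem mobius_eq_Tv (P Q : ℤ) (hD : P ^ 2 - 4 * Q ≠ 0)
    (hnd : ∀ m : ℕ, 1 ≤ m → lucasU P Q m ≠ 0) (n : ℕ) (hn : 0 < n) :
    mobiusDualU P Q n = (Tv n P Q : ℚ) := by
  have h := (ArithmeticFunction.prod_eq_iff_prod_pow_moebius_eq_of_nonzero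
    (R := ℚ) (f := fun d => (Tv d P Q : ℚ)) (g := fun d => (lucasU P Q d : ℚ)) ?_ ?_).1 ?_ n hn
  · rw [← h, mobiusDualU]
    exact (Nat.prod_divisorsAntidiagonal'
      (f := fun i j => (lucasU P Q j : ℚ) ^ (ArithmeticFunction.moebius i))).symm
  · intro k hk
    have h1 := Tv_prod P Q hD k hk
    have h2 := hnd k hk
    rw [← h1, Finset.prod_ne_zero_iff] at h2
    exact_mod_cast h2 k (by simp; omega)
  · intro k hk
    exact_mod_cast hnd k hk
  · intro k hk
    exact_mod_cast Tv_prod P Q hD k hk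

/-- `m` is the entry point of `q`. -/
def IsEntry (P Q : ℤ) (q m : ℕ) : Prop :=
  (q : ℤ) ∣ lucasU P Q m ∧ ∀ j : ℕ, 1 ≤ j → j < m → ¬ (q : ℤ) ∣ lucasU P Q j

theorem lucasU_congr (N P Q P' Q' : ℤ) (h1 : N ∣ P - P') (h2 : N ∣ Q - Q') (k : ℕ) :
    N ∣ lucasU P Q k - lucasU P' Q' k := by
  induction k using Nat.strong_induction_on with
  | _ k ih =>
  match k with
  | 0 => simp [lucasU]
  | 1 => simp [lucasU]
  | k + 2 =>
    obtain ⟨x, hx⟩ := ih (k + 1) (by omega)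
    obtain ⟨y, hy⟩ := ih k (by omega)
    obtain ⟨z, hz⟩ := h1
    obtain ⟨w, hw⟩ := h2
    rw [lucasU, lucasU]
    exact ⟨P * x + z * lucasU P' Q' (k + 1) - Q * y - w * lucasU P' Q' k, by
      linear_combination P * hx + lucasU P' Q' (k + 1) * hz - Q * hy - lucasU P' Q' k * hw⟩

theorem castK {q : ℕ} [Fact q.Prime] (x : ℤ) :
    (x : AlgebraicClosure (ZMod q)) = 0 ↔ (q : ℤ) ∣ x :=
  CharP.intCast_eq_zero_iff _ q x

theorem not_dvd_Q_of_dvd_U (P Q : ℤ) (q : ℕ) (hq : q.Prime) (m : ℕ) (hm : 1 ≤ m)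
    (hPQ : ¬ ((q : ℤ) ∣ P ∧ (q : ℤ) ∣ Q)) (h : (q : ℤ) ∣ lucasU P Q m) : ¬ (q : ℤ) ∣ Q := by
  have := Fact.mk hq
  intro hQ
  obtain ⟨a, b, h1, h2⟩ := exists_roots (AlgebraicClosure (ZMod q)) P Q
  have e := lucasU_cast h1 h2 m
  rw [(castK _).2 h, zero_mul] at e
  rw [(castK _).2 hQ] at h2
  have hm0 : m ≠ 0 := by omega
  have hab : a = 0 ∧ b = 0 := by
    rcases mul_eq_zero.1 h2 with rfl | rfl
    · rw [zero_pow hm0] at e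
      exact ⟨rfl, pow_eq_zero_iff hm0 |>.1 (by linear_combination e)⟩
    · rw [zero_pow hm0] at e
      exact ⟨pow_eq_zero_iff hm0 |>.1 (by linear_combination -e), rfl⟩
  apply hPQ
  refine ⟨(castK _).1 ?_, hQ⟩
  rw [← h1, hab.1, hab.2, add_zero]

theorem Tv_dvd_U (P Q : ℤ) (hD : P ^ 2 - 4 * Q ≠ 0) (m : ℕ) (hm : 0 < m) :
    Tv m P Q ∣ lucasU P Q m := by
  rw [← Tv_prod P Q hD m hm]
  apply Finset.dvd_prod_of_mem
  simp; omega

theorem entry_of_dvd_Tv (P Q : ℤ) (hD : P ^ 2 - 4 * Q ≠ 0) (q : ℕ) (hq : q.Prime) (m : ℕ)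
    (hm2 : 2 ≤ m) (hm : ¬ q ∣ m)
    (hPQ : ¬ ((q : ℤ) ∣ P ∧ (q : ℤ) ∣ Q)) (h : (q : ℤ) ∣ Tv m P Q) : IsEntry P Q q m := by
  have := Fact.mk hq
  have hU : (q : ℤ) ∣ lucasU P Q m := h.trans (Tv_dvd_U P Q hD m (by omega))
  have hQ := not_dvd_Q_of_dvd_U P Q q hq m (by omega) hPQ hU
  refine ⟨hU, fun j hj hjm hd => ?_⟩
  obtain ⟨a, b, h1, h2⟩ := exists_roots (AlgebraicClosure (ZMod q)) P Q
  have hb : b ≠ 0 := by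
    rintro rfl
    exact hQ ((castK _).1 (by rw [← h2, mul_zero]))
  have e1 := Tv_cast hm2 h1 h2
  rw [(castK _).2 h, aeval_homCyc _ _ _ hb] at e1
  have e2 := (mul_eq_zero.1 e1.symm).resolve_left (pow_ne_zero _ hb)
  have : NeZero ((m : ℕ) : AlgebraicClosure (ZMod q)) := ⟨by
    rw [Ne, CharP.cast_eq_zero_iff _ q]; exact hm⟩
  have e3 := Polynomial.isRoot_cyclotomic_iff.1 e2
  have e4 := lucasU_cast h1 h2 j
  rw [(castK _).2 hd, zero_mul] at e4
  have e5 : (a / b) ^ j = 1 := by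
    rw [div_pow, div_eq_one_iff_eq (pow_ne_zero _ hb)]
    linear_combination -e4
  exact absurd (Nat.le_of_dvd (by omega) (e3.dvd_of_pow_eq_one _ e5)) (by omega)

theorem gauss_V_base (q : ℕ) (hq : q.Prime) (P Q : ℤ) (c : ℕ) :
    (q : ℤ) ∣ lucasV P Q (q ^ c) - P := by
  induction c with
  | zero => simp [lucasV, lucasU]; ring_nf; simp
  | succ c ih =>
    have h := (dvd_pow_self (q : ℤ) (Nat.succ_ne_zero c)).trans (gauss_V q hq P Q c)
    have := dvd_add h ih
    simpa using this

theorem gauss_Q_base (q : ℕ) (hq : q.Prime) (Q : ℤ) (c : ℕ) :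
    (q : ℤ) ∣ Q ^ (q ^ c) - Q := by
  induction c with
  | zero => simp
  | succ c ih =>
    have h := (dvd_pow_self (q : ℤ) (Nat.succ_ne_zero c)).trans (gauss_Q q hq Q c)
    have := dvd_add h ih
    simpa using this

theorem cop_of_not_dvd {q : ℕ} (hq : q.Prime) {x : ℤ} (h : ¬ (q : ℤ) ∣ x) (c : ℕ) :
    IsCoprime ((q : ℤ) ^ c) x :=
  IsCoprime.pow_left (((Nat.prime_iff_prime_int.1 hq).coprime_iff_not_dvd).2 h)

theorem caseA (P Q : ℤ) (hQ : Q ≠ 0) (hD : P ^ 2 - 4 * Q ≠ 0) (q : ℕ) (hq : q.Prime) (m : ℕ)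
    (hm2 : 2 ≤ m) (hm : ¬ q ∣ m)
    (hPQ : ¬ ((q : ℤ) ∣ P ∧ (q : ℤ) ∣ Q)) (hE : ¬ IsEntry P Q q m) (c : ℕ) :
    (q : ℤ) ^ (c + 1) ∣ Tv (q ^ (c + 1) * m) P Q - 1 := by
  have h0 : ¬ (q : ℤ) ∣ Tv m P Q := fun h => hE (entry_of_dvd_Tv P Q hD q hq m hm2 hm hPQ h)
  have h1 : ¬ (q : ℤ) ∣ Tv m (lucasV P Q (q ^ c)) (Q ^ q ^ c) := by
    intro h
    apply h0
    have := Tv_congr m q _ _ _ _ (gauss_V_base q hq P Q c) (gauss_Q_base q hq Q c)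
    have := dvd_sub h this
    simpa using this
  have h2 := Tv_congr m (q ^ (c + 1)) _ _ _ _ (by exact_mod_cast gauss_V q hq P Q c)
    (by exact_mod_cast gauss_Q q hq Q c)
  rw [← Tv_mul P Q hQ q hq m hm2 hm c, ← sub_one_mul] at h2
  push_cast at h2
  exact (cop_of_not_dvd hq h1 _).dvd_of_dvd_mul_right h2

theorem lucasU_double {A : Type} [CommRing A] {P Q : ℤ} {a : A}
    (h1 : a + a = P) (h2 : a * a = Q) (k : ℕ) :
    (lucasU P Q (k + 1) : A) = (k + 1) * a ^ k := by
  induction k with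
  | zero => simp [lucasU]
  | succ k ih =>
    rw [lucasU_succ_cast h1 h2, ih]; push_cast; ring

theorem entry_facts (P Q : ℤ) (q : ℕ) (hq : q.Prime) (hq2 : q ≠ 2) (m : ℕ)
    (hm2 : 2 ≤ m) (hm : ¬ q ∣ m)
    (hPQ : ¬ ((q : ℤ) ∣ P ∧ (q : ℤ) ∣ Q)) (hE : IsEntry P Q q m) :
    ¬ (q : ℤ) ∣ P ^ 2 - 4 * Q ∧
    (q : ℤ) ∣ lucasU P Q q - jacobiSym (P ^ 2 - 4 * Q) q ∧
    ((jacobiSym (P ^ 2 - 4 * Q) q = 1 ∧ m ∣ q - 1) ∨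
      (jacobiSym (P ^ 2 - 4 * Q) q = -1 ∧ m ∣ q + 1)) := by
  have := Fact.mk hq
  have hQ := not_dvd_Q_of_dvd_U P Q q hq m (by omega) hPQ hE.1
  obtain ⟨a, b, h1, h2⟩ := exists_roots (AlgebraicClosure (ZMod q)) P Q
  have hb : b ≠ 0 := by
    rintro rfl
    exact hQ ((castK _).1 (by rw [← h2, mul_zero]))
  have ha : a ≠ 0 := by
    rintro rfl
    exact hQ ((castK _).1 (by rw [← h2, zero_mul]))
  have eD : (a - b) ^ 2 = ((P ^ 2 - 4 * Q : ℤ) : AlgebraicClosure (ZMod q)) := by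
    push_cast; rw [← h1, ← h2]; ring
  have hab : a - b ≠ 0 := by
    intro h
    obtain rfl : a = b := sub_eq_zero.1 h
    obtain ⟨k, rfl⟩ : ∃ k, m = k + 1 := ⟨m - 1, by omega⟩
    have e := lucasU_double h1 h2 k
    rw [(castK _).2 hE.1] at e
    have e' := (mul_eq_zero.1 e.symm).resolve_right (pow_ne_zero _ ha)
    have e'' : ((k + 1 : ℕ) : AlgebraicClosure (ZMod q)) = 0 := by exact_mod_cast e'
    rw [CharP.cast_eq_zero_iff _ q] at e''
    exact hm e''
  have hDq : ¬ (q : ℤ) ∣ P ^ 2 - 4 * Q := by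
    rw [← castK, ← eD]
    exact pow_ne_zero _ hab
  have hodd := hq.eq_two_or_odd.resolve_left hq2
  have hε : ((jacobiSym (P ^ 2 - 4 * Q) q : ℤ) : AlgebraicClosure (ZMod q)) = (a - b) ^ (q - 1) := by
    rw [← jacobiSym.legendreSym.to_jacobiSym]
    have := congrArg (algebraMap (ZMod q) (AlgebraicClosure (ZMod q)))
      (legendreSym.eq_pow q (P ^ 2 - 4 * Q))
    rw [map_intCast, map_pow, map_intCast, ← eD, ← pow_mul] at this
    rw [this]
    congr 1
    omega
  have hδ : (a - b) ^ q = (jacobiSym (P ^ 2 - 4 * Q) q : ℤ) * (a - b) := by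
    rw [hε, ← pow_succ]
    congr 1
    have := hq.pos
    omega
  have hδ' : (a - b) ^ q = a ^ q - b ^ q := sub_pow_char _ _
  have hs : a ^ q + b ^ q = a + b := by
    rw [← add_pow_char, h1]
    have := (castK (q := q) (P ^ q - P)).2 (fermat_dvd q hq P)
    push_cast at this
    linear_combination this
  have hUq : (q : ℤ) ∣ lucasU P Q q - jacobiSym (P ^ 2 - 4 * Q) q := by
    rw [← castK]
    push_cast
    apply mul_right_cancel₀ hab
    rw [sub_mul, lucasU_cast h1 h2, ← hδ, hδ', zero_mul, sub_self]
  have h20 : (2 : AlgebraicClosure (ZMod q)) ≠ 0 := by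
    have : ((2 : ℕ) : AlgebraicClosure (ZMod q)) ≠ 0 := by
      rw [Ne, CharP.cast_eq_zero_iff _ q]
      intro h
      exact hq2 ((Nat.prime_dvd_prime_iff_eq hq Nat.prime_two).1 h)
    exact_mod_cast this
  have hprim : IsPrimitiveRoot (a / b) m := by
    apply IsPrimitiveRoot.mk_of_lt _ (by omega)
    · rw [div_pow, div_eq_one_iff_eq (pow_ne_zero _ hb)]
      have e := lucasU_cast h1 h2 m
      rw [(castK _).2 hE.1] at e
      linear_combination -e
    · intro j hj hjm h
      rw [div_pow, div_eq_one_iff_eq (pow_ne_zero _ hb)] at h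
      apply hE.2 j hj hjm
      rw [← castK]
      apply mul_right_cancel₀ hab
      rw [lucasU_cast h1 h2, h]; ring
  refine ⟨hDq, hUq, ?_⟩
  have hg : Int.gcd (P ^ 2 - 4 * Q) q = 1 := by
    rw [← Int.isCoprime_iff_gcd_eq_one]
    simpa using (cop_of_not_dvd hq hDq 1).symm
  rcases jacobiSym.eq_one_or_neg_one hg with h | h
  · left
    refine ⟨h, hprim.dvd_of_pow_eq_one _ ?_⟩
    rw [h, hδ'] at hδ
    push_cast at hδ
    have ea : a ^ q = a := mul_left_cancel₀ h20 (by linear_combination hδ + hs)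
    have eb : b ^ q = b := mul_left_cancel₀ h20 (by linear_combination hs - hδ)
    rw [div_pow, div_eq_one_iff_eq (pow_ne_zero _ hb)]
    obtain ⟨r, rfl⟩ : ∃ r, q = r + 1 := ⟨q - 1, by have := hq.pos; omega⟩
    rw [pow_succ] at ea eb
    have ea' : a ^ r = 1 := mul_right_cancel₀ ha (by rw [ea, one_mul])
    have eb' : b ^ r = 1 := mul_right_cancel₀ hb (by rw [eb, one_mul])
    simp [ea', eb']
  · right
    refine ⟨h, hprim.dvd_of_pow_eq_one _ ?_⟩
    rw [h, hδ'] at hδ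
    push_cast at hδ
    have ea : a ^ q = b := mul_left_cancel₀ h20 (by linear_combination hδ + hs)
    have eb : b ^ q = a := mul_left_cancel₀ h20 (by linear_combination hs - hδ)
    rw [div_pow, div_eq_one_iff_eq (pow_ne_zero _ hb), pow_succ, pow_succ, ea, eb, mul_comm]

theorem lucasU_mod_disc (s t : ℤ) (k : ℕ) :
    s ^ 2 - 4 * t ∣ 2 ^ k * lucasU s t (k + 1) - (k + 1) * s ^ k := by
  induction k using Nat.strong_induction_on with
  | _ k ih =>
  match k with
  | 0 => simp [lucasU]
  | 1 => norm_num [lucasU]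
  | k + 2 =>
    obtain ⟨x, hx⟩ := ih (k + 1) (by omega)
    obtain ⟨y, hy⟩ := ih k (by omega)
    refine ⟨2 * s * x - 4 * t * y + (k + 1) * s ^ k, ?_⟩
    rw [lucasU]
    push_cast at hx hy ⊢
    linear_combination 2 * s * hx - 4 * t * hy

theorem lucasV_mod_disc (s t : ℤ) (k : ℕ) :
    s ^ 2 - 4 * t ∣ 2 ^ k * lucasV s t (k + 1) - s ^ (k + 1) := by
  obtain ⟨x, hx⟩ := lucasU_mod_disc s t k
  obtain ⟨y, hy⟩ := lucasU_mod_disc s t (k + 1)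
  refine ⟨y - s * x, ?_⟩
  rw [lucasV]
  push_cast at hx hy ⊢
  linear_combination hy - s * hx

theorem not_dvd_two_pow {p : ℕ} (hp : p.Prime) (hp2 : p ≠ 2) (k : ℕ) : ¬ (p : ℤ) ∣ 2 ^ k := by
  intro h
  have h1 : p ∣ 2 ^ k := by exact_mod_cast h
  exact hp2 ((Nat.prime_dvd_prime_iff_eq hp Nat.prime_two).1 (hp.dvd_of_dvd_pow h1))

theorem fermat_sub_one {p : ℕ} (hp : p.Prime) {x : ℤ} (h : ¬ (p : ℤ) ∣ x) :
    (p : ℤ) ∣ x ^ (p - 1) - 1 := by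
  have := Fact.mk hp
  rw [← ZMod.intCast_zmod_eq_zero_iff_dvd] at h ⊢
  push_cast
  rw [ZMod.pow_card_sub_one_eq_one h, sub_self]

theorem B1 (P Q : ℤ) (hD : P ^ 2 - 4 * Q ≠ 0) (p : ℕ) (hp : p.Prime) (hp2 : p ≠ 2) (m : ℕ)
    (hQ : ¬ (p : ℤ) ∣ Q) (hU : (p : ℤ) ∣ lucasU P Q m) (i : ℕ) :
    (p : ℤ) ^ (i + 1) ∣ lucasU P Q (p ^ i * m) ∧
    (p : ℤ) ^ (i + 1) ∣ lucasV P Q (p ^ i * m) ^ (p - 1) - 2 ^ (p - 1) := by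
  have hpp := Nat.prime_iff_prime_int.1 hp
  obtain ⟨r, hr⟩ : ∃ r, p = r + 1 := ⟨p - 1, by have := hp.pos; omega⟩
  have hr' : p - 1 = r := by omega
  induction i with
  | zero =>
    simp only [zero_add, pow_one, pow_zero, one_mul]
    refine ⟨hU, ?_⟩
    have hV : ¬ (p : ℤ) ∣ lucasV P Q m := by
      intro h
      have e := lucasV_lucasU_sq P Q m
      have h4 : (p : ℤ) ∣ 2 ^ 2 * Q ^ m := by
        have e' : 2 ^ 2 * Q ^ m = lucasV P Q m ^ 2 - (P ^ 2 - 4 * Q) * lucasU P Q m ^ 2 := by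
          linear_combination -e
        rw [e']
        exact dvd_sub (dvd_pow h two_ne_zero) (Dvd.dvd.mul_left (dvd_pow hU two_ne_zero) _)
      rcases hpp.dvd_or_dvd h4 with h | h
      · exact not_dvd_two_pow hp hp2 2 h
      · exact hQ (hpp.dvd_of_dvd_pow h)
    have := dvd_sub (fermat_sub_one hp hV)
      (fermat_sub_one hp (x := 2) (by simpa using not_dvd_two_pow hp hp2 1))
    simpa using this
  | succ i ih =>
    obtain ⟨ih1, ih2⟩ := ih
    set k := p ^ i * m with hk
    have hk' : p ^ (i + 1) * m = k * p := by rw [hk]; ring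
    rw [hk']
    have hΔ : (p : ℤ) ^ (i + 2) ∣ lucasV P Q k ^ 2 - 4 * Q ^ k := by
      rw [lucasV_lucasU_sq]
      apply Dvd.dvd.mul_left
      refine (pow_dvd_pow (p : ℤ) (show i + 2 ≤ (i + 1) * 2 by omega)).trans ?_
      rw [pow_mul]
      exact pow_dvd_pow_of_dvd ih1 2
    have hu := lucasU_mod_disc (lucasV P Q k) (Q ^ k) r
    have hv := lucasV_mod_disc (lucasV P Q k) (Q ^ k) r
    rw [← hr] at hu hv
    constructor
    · rw [lucasU_mul P Q hD, pow_succ]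
      apply mul_dvd_mul ih1
      have h1 : (p : ℤ) ∣ 2 ^ r * lucasU (lucasV P Q k) (Q ^ k) p - (r + 1) * lucasV P Q k ^ r :=
        ((dvd_pow_self (p : ℤ) (by omega)).trans hΔ).trans hu
      have h2 : (p : ℤ) ∣ (r + 1) * lucasV P Q k ^ r := ⟨lucasV P Q k ^ r, by rw [hr]; push_cast; ring⟩
      have h3 := dvd_add h1 h2
      rw [sub_add_cancel] at h3
      exact (hpp.dvd_or_dvd h3).resolve_left (not_dvd_two_pow hp hp2 r)
    · rw [lucasV_mul]
      have h1 := hΔ.trans hv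
      have h2 := pow_prime_lift p hp i _ _ ih2
      have h3 := h1.trans (sub_dvd_pow_sub_pow _ _ r)
      rw [hr'] at h2 ⊢
      have h4 := dvd_add h3 h2
      have e : (2 ^ r * lucasV (lucasV P Q k) (Q ^ k) p) ^ r - (lucasV P Q k ^ p) ^ r +
          ((lucasV P Q k ^ r) ^ p - (2 ^ r) ^ p)
          = 2 ^ (r * r) * (lucasV (lucasV P Q k) (Q ^ k) p ^ r - 2 ^ r) := by
        rw [hr]; ring
      rw [e] at h4
      exact (cop_of_not_dvd hp (not_dvd_two_pow hp hp2 _) _).dvd_of_dvd_mul_left h4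

theorem B2 (P Q : ℤ) (hD : P ^ 2 - 4 * Q ≠ 0) (p : ℕ) (hp : p.Prime) (hp2 : p ≠ 2) (m : ℕ)
    (hQ : ¬ (p : ℤ) ∣ Q) (hU : (p : ℤ) ∣ lucasU P Q m) (c : ℕ) :
    (p : ℤ) ^ (c + 1) ∣ lucasU (lucasV P Q (p ^ c * m)) (Q ^ (p ^ c * m)) p - p := by
  obtain ⟨r, hr⟩ : ∃ r, p = r + 1 := ⟨p - 1, by have := hp.pos; omega⟩
  have hr' : p - 1 = r := by omega
  obtain ⟨h1, h2⟩ := B1 P Q hD p hp hp2 m hQ hU c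
  set k := p ^ c * m with hk
  have hΔ : (p : ℤ) ^ (c + 1) ∣ lucasV P Q k ^ 2 - 4 * Q ^ k := by
    rw [lucasV_lucasU_sq]
    apply Dvd.dvd.mul_left
    exact dvd_pow h1 two_ne_zero
  have hu := hΔ.trans (lucasU_mod_disc (lucasV P Q k) (Q ^ k) r)
  rw [← hr] at hu
  rw [hr'] at h2
  have h3 := dvd_add hu (Dvd.dvd.mul_left h2 (p : ℤ))
  have hrz : (p : ℤ) = r + 1 := by rw [hr]; push_cast; ring
  have e : 2 ^ r * lucasU (lucasV P Q k) (Q ^ k) p - (r + 1) * lucasV P Q k ^ r +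
      p * (lucasV P Q k ^ r - 2 ^ r) = 2 ^ r * (lucasU (lucasV P Q k) (Q ^ k) p - p) := by
    linear_combination (lucasV P Q k ^ r) * hrz
  rw [e] at h3
  exact (cop_of_not_dvd hp (not_dvd_two_pow hp hp2 _) _).dvd_of_dvd_mul_left h3

theorem B3 (P Q : ℤ) (hD : P ^ 2 - 4 * Q ≠ 0)
    (hnd : ∀ m : ℕ, 1 ≤ m → lucasU P Q m ≠ 0) (p : ℕ) (hp : p.Prime) (m : ℕ) (hm0 : 0 < m)
    (hm : ¬ p ∣ m) (c : ℕ) :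
    lucasU (lucasV P Q (p ^ c * m)) (Q ^ (p ^ c * m)) p
      = ∏ d ∈ m.divisors, Tv (p ^ (c + 1) * d) P Q := by
  have hpos : 0 < p ^ c * m := Nat.mul_pos (pow_pos hp.pos _) hm0
  have hpos' : 0 < p ^ (c + 1) * m := Nat.mul_pos (pow_pos hp.pos _) hm0
  apply mul_left_cancel₀ (hnd _ hpos)
  rw [← lucasU_mul P Q hD, show p ^ c * m * p = p ^ (c + 1) * m by ring,
    ← Tv_prod P Q hD _ hpos, ← Tv_prod P Q hD _ hpos']
  have hinj : Set.InjOn (fun d => p ^ (c + 1) * d) (m.divisors : Set ℕ) := by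
    intro x _ y _ h
    exact Nat.eq_of_mul_eq_mul_left (pow_pos hp.pos (c + 1)) h
  rw [← Finset.prod_image (f := fun d => Tv d P Q) hinj, ← Finset.prod_union]
  · congr 1
    ext d
    simp only [Finset.mem_union, Nat.mem_divisors, Finset.mem_image]
    constructor
    · rintro ⟨hd, -⟩
      by_cases h : p ^ (c + 1) ∣ d
      · right
        obtain ⟨e, rfl⟩ := h
        exact ⟨e, ⟨Nat.dvd_of_mul_dvd_mul_left (pow_pos hp.pos _) hd, hm0.ne'⟩, rfl⟩
      · left
        refine ⟨?_, hpos.ne'⟩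
        obtain ⟨x, y, hx, hy, rfl⟩ := exists_dvd_and_dvd_of_dvd_mul hd
        obtain ⟨i, hi, rfl⟩ := (Nat.dvd_prime_pow hp).1 hx
        have : i ≠ c + 1 := by
          rintro rfl; exact h (dvd_mul_right _ _)
        exact mul_dvd_mul (pow_dvd_pow p (by omega)) hy
    · rintro (⟨hd, -⟩ | ⟨e, ⟨he, -⟩, rfl⟩)
      · exact ⟨hd.trans (mul_dvd_mul (pow_dvd_pow p (by omega)) dvd_rfl), hpos'.ne'⟩
      · exact ⟨mul_dvd_mul dvd_rfl he, hpos'.ne'⟩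
  · rw [Finset.disjoint_left]
    intro d hd hd'
    simp only [Nat.mem_divisors, Finset.mem_image] at hd hd'
    obtain ⟨e, ⟨he, -⟩, rfl⟩ := hd'
    have h1 := hd.1
    rw [pow_succ, mul_assoc] at h1
    have h2 := Nat.dvd_of_mul_dvd_mul_left (pow_pos hp.pos _) h1
    exact hm ((dvd_mul_right p e).trans h2)

theorem B4 (P Q : ℤ) (hD : P ^ 2 - 4 * Q ≠ 0)
    (hnd : ∀ m : ℕ, 1 ≤ m → lucasU P Q m ≠ 0) (p : ℕ) (hp : p.Prime) (hp2 : p ≠ 2)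
    (hDp : ¬ (p : ℤ) ∣ P ^ 2 - 4 * Q) (ε : ℤ) (hε : ε = 1 ∨ ε = -1)
    (hU : (p : ℤ) ∣ lucasU P Q p - ε) (c : ℕ) :
    (p : ℤ) ^ (c + 1) ∣ Tv (p ^ (c + 1)) P Q - ε := by
  have hpp := Nat.prime_iff_prime_int.1 hp
  have h1 := B3 P Q hD hnd p hp 1 one_pos (fun h => hp.one_lt.ne' (Nat.dvd_one.1 h)) c
  simp only [mul_one, Nat.divisors_one, Finset.prod_singleton] at h1
  rw [← h1]
  set W := lucasU (lucasV P Q (p ^ c)) (Q ^ p ^ c) p with hW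
  have hWε : (p : ℤ) ∣ W - ε := by
    have h2 := lucasU_congr p _ _ _ _ (gauss_V_base p hp P Q c) (gauss_Q_base p hp Q c) p
    have h3 := dvd_add h2 hU
    rw [← hW] at h3
    simpa using h3
  have hdisc : ¬ (p : ℤ) ∣ (P ^ 2 - 4 * Q) * lucasU P Q (p ^ c) ^ 2 := by
    rw [← lucasV_lucasU_sq]
    intro h
    apply hDp
    obtain ⟨x, hx⟩ := h
    obtain ⟨y, hy⟩ := gauss_V_base p hp P Q c
    obtain ⟨z, hz⟩ := gauss_Q_base p hp Q c
    exact ⟨x - y * (lucasV P Q (p ^ c) + P) + 4 * z, by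
      linear_combination hx - (lucasV P Q (p ^ c) + P) * hy + 4 * hz⟩
  have hsq : (p : ℤ) ^ (c + 1) ∣ (P ^ 2 - 4 * Q) * lucasU P Q (p ^ c) ^ 2 * ((W - 1) * (W + 1)) := by
    have e1 := lucasV_lucasU_sq P Q (p ^ c)
    have e2 := lucasV_lucasU_sq P Q (p ^ (c + 1))
    have e3 : lucasU P Q (p ^ (c + 1)) = lucasU P Q (p ^ c) * W := by
      rw [pow_succ, lucasU_mul P Q hD]
    rw [e3] at e2
    obtain ⟨y, hy⟩ := gauss_V p hp P Q c
    obtain ⟨z, hz⟩ := gauss_Q p hp Q c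
    exact ⟨y * (lucasV P Q (p ^ (c + 1)) + lucasV P Q (p ^ c)) - 4 * z, by
      linear_combination e1 - e2 + (lucasV P Q (p ^ (c + 1)) + lucasV P Q (p ^ c)) * hy - 4 * hz⟩
  have h5 := (cop_of_not_dvd hp hdisc _).dvd_of_dvd_mul_left hsq
  have h2 : ¬ (p : ℤ) ∣ 2 := by simpa using not_dvd_two_pow hp hp2 1
  rcases hε with rfl | rfl
  · apply (cop_of_not_dvd hp _ _).dvd_of_dvd_mul_right h5
    intro h
    apply h2
    have := dvd_sub h hWε
    ring_nf at this
    exact this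
  · rw [mul_comm] at h5
    rw [sub_neg_eq_add] at *
    apply (cop_of_not_dvd hp _ _).dvd_of_dvd_mul_right h5
    intro h
    apply h2
    have := dvd_sub hWε h
    ring_nf at this
    exact this

theorem caseB (P Q : ℤ) (hQ : Q ≠ 0) (hD : P ^ 2 - 4 * Q ≠ 0)
    (hnd : ∀ m : ℕ, 1 ≤ m → lucasU P Q m ≠ 0) (p : ℕ) (hp : p.Prime) (hp2 : p ≠ 2) (m : ℕ)
    (hm2 : 2 ≤ m) (hm : ¬ p ∣ m)
    (hPQ : ¬ ((p : ℤ) ∣ P ∧ (p : ℤ) ∣ Q)) (hE : IsEntry P Q p m) (c : ℕ) :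
    (p : ℤ) ^ (c + 1) ∣ Tv (p ^ (c + 1) * m) P Q - jacobiSym (P ^ 2 - 4 * Q) p * p := by
  obtain ⟨hDp, hUp, hε⟩ := entry_facts P Q p hp hp2 m hm2 hm hPQ hE
  have hQp := not_dvd_Q_of_dvd_U P Q p hp m (by omega) hPQ hE.1
  have hε' : jacobiSym (P ^ 2 - 4 * Q) p = 1 ∨ jacobiSym (P ^ 2 - 4 * Q) p = -1 :=
    hε.imp And.left And.left
  set ε := jacobiSym (P ^ 2 - 4 * Q) p
  have h4 := B4 P Q hD hnd p hp hp2 hDp ε hε' hUp c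
  have h2 := B2 P Q hD p hp hp2 m hQp hE.1 c
  rw [B3 P Q hD hnd p hp m (by omega) hm c,
    ← Nat.cons_self_properDivisors (by omega), Finset.prod_cons,
    ← Finset.mul_prod_erase _ _ (show 1 ∈ m.properDivisors by simp; omega), mul_one] at h2
  have h5 : ∀ d ∈ m.properDivisors.erase 1,
      ((Tv (p ^ (c + 1) * d) P Q : ℤ) : ZMod (p ^ (c + 1))) = 1 := by
    intro d hd
    rw [Finset.mem_erase, Nat.mem_properDivisors] at hd
    obtain ⟨hd1, hd2, hd3⟩ := hd
    have hd0 : d ≠ 0 := by rintro rfl; simp at hd2; omega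
    have := caseA P Q hQ hD p hp d (by omega) (fun h => hm (h.trans hd2)) hPQ
      (fun h => hE.2 d (by omega) hd3 h.1) c
    rw [← sub_eq_zero]
    have h' := (ZMod.intCast_zmod_eq_zero_iff_dvd (Tv (p ^ (c + 1) * d) P Q - 1)
      (p ^ (c + 1))).2 (by exact_mod_cast this)
    push_cast at h'
    exact h'
  have h6 : ((∏ d ∈ m.properDivisors.erase 1, Tv (p ^ (c + 1) * d) P Q : ℤ) :
      ZMod (p ^ (c + 1))) = 1 := by
    push_cast
    exact Finset.prod_eq_one h5
  have h7 : (p : ℤ) ^ (c + 1) ∣ (∏ d ∈ m.properDivisors.erase 1, Tv (p ^ (c + 1) * d) P Q) - 1 := by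
    have := (ZMod.intCast_zmod_eq_zero_iff_dvd
      ((∏ d ∈ m.properDivisors.erase 1, Tv (p ^ (c + 1) * d) P Q) - 1) (p ^ (c + 1))).1
      (by rw [Int.cast_sub, h6]; simp)
    exact_mod_cast this
  obtain ⟨x, hx⟩ := h2
  obtain ⟨y, hy⟩ := h7
  obtain ⟨z, hz⟩ := h4
  have hεε : ε * ε = 1 := by rcases hε' with h | h <;> rw [h] <;> norm_num
  set A := Tv (p ^ (c + 1) * m) P Q
  set B := Tv (p ^ (c + 1)) P Q
  set R := ∏ d ∈ m.properDivisors.erase 1, Tv (p ^ (c + 1) * d) P Q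
  exact ⟨ε * (x - A * B * y - A * z), by
    linear_combination ε * hx - ε * A * B * hy - ε * A * hz - A * hεε⟩

theorem entry_le (P Q : ℤ) (n : ℕ) (hn : 1 < n) (p : ℕ) (hp : p.Prime) (hpn : p ∣ n)
    (hmax : ∀ q : ℕ, q.Prime → q ∣ n → q ≤ p)
    (hexc : ¬ (¬ (2 : ℤ) ∣ P ∧ ¬ (2 : ℤ) ∣ Q ∧ n / 2 ^ (n.factorization 2) = 3))
    (q : ℕ) (hq : q.Prime) (hqn : q ∣ n) (hPQ : ¬ ((q : ℤ) ∣ P ∧ (q : ℤ) ∣ Q))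
    (hm2 : 2 ≤ n / q ^ (n.factorization q))
    (hE : IsEntry P Q q (n / q ^ (n.factorization q))) : q = p := by
  by_contra hne
  have hlt : q < p := lt_of_le_of_ne (hmax q hq hqn) hne
  have hm : ¬ q ∣ n / q ^ (n.factorization q) := Nat.not_dvd_ordCompl hq (by omega)
  have hpm : p ∣ n / q ^ (n.factorization q) := by
    have h := Nat.ordProj_mul_ordCompl_eq_self n q
    rw [← h] at hpn
    refine (hp.dvd_mul.1 hpn).resolve_left fun h' => ?_
    exact hne ((Nat.prime_dvd_prime_iff_eq hp hq).1 (hp.dvd_of_dvd_pow h')).symm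
  have hQ := not_dvd_Q_of_dvd_U P Q q hq _ (by omega) hPQ hE.1
  by_cases hq2 : q = 2
  · subst hq2
    set m := n / 2 ^ (n.factorization 2) with hmdef
    apply hexc
    have hm3 : 3 ≤ m := by omega
    have hP := hE.2 2 (by omega) (by omega)
    have e2 : lucasU P Q 2 = P := by simp [lucasU]
    have e3 : lucasU P Q 3 = P * P - Q := by simp [lucasU]
    rw [e2] at hP
    push_cast at hP hQ
    refine ⟨hP, hQ, ?_⟩
    by_contra h3
    have := hE.2 3 (by omega) (by omega)
    rw [e3] at this
    apply this
    push_cast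
    have o1 : Odd P := by rwa [← Int.not_even_iff_odd, even_iff_two_dvd]
    have o2 : Odd Q := by rwa [← Int.not_even_iff_odd, even_iff_two_dvd]
    exact even_iff_two_dvd.1 ((o1.mul o1).sub_odd o2)
  · obtain ⟨-, -, h⟩ := entry_facts P Q q hq hq2 _ hm2 hm hPQ hE
    have o1 := hq.eq_two_or_odd.resolve_left hq2
    have o2 := hp.eq_two_or_odd.resolve_left (by have := hq.two_le; omega)
    rcases h with ⟨-, h⟩ | ⟨-, h⟩
    · have := Nat.le_of_dvd (by have := hq.two_le; omega) (hpm.trans h)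
      omega
    · have := Nat.le_of_dvd (by omega) (hpm.trans h)
      omega

theorem dvd_of_local (n : ℕ) (x : ℤ)
    (h : ∀ q : ℕ, q.Prime → q ∣ n → (q : ℤ) ^ (n.factorization q) ∣ x) (hn : n ≠ 0) :
    (n : ℤ) ∣ x := by
  rw [Int.natCast_dvd, Nat.dvd_iff_prime_pow_dvd_dvd]
  intro q k hq hk
  rcases Nat.eq_zero_or_pos k with rfl | hk0
  · simp
  have h1 := h q hq ((dvd_pow_self q hk0.ne').trans hk)
  have h2 : q ^ (n.factorization q) ∣ x.natAbs := by
    rw [← Int.natCast_dvd]; exact_mod_cast h1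
  exact (pow_dvd_pow q ((hq.pow_dvd_iff_le_factorization hn).1 hk)).trans h2

theorem two_le_ordCompl (n : ℕ) (hn : 1 < n) (hnpf : 1 < n.primeFactors.card) (q : ℕ)
    (hq : q.Prime) : 2 ≤ n / q ^ (n.factorization q) := by
  have h0 := Nat.ordCompl_pos q (n := n) (by omega)
  by_contra hlt
  have h1 : n / q ^ (n.factorization q) = 1 := by omega
  have h := Nat.ordProj_mul_ordCompl_eq_self n q
  rw [h1, mul_one] at h
  have h2 : n.primeFactors ⊆ {q} := by
    rw [← h]
    intro x hx
    rw [Nat.mem_primeFactors] at hx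
    rw [Finset.mem_singleton]
    exact (Nat.prime_dvd_prime_iff_eq hx.1 hq).1 (hx.1.dvd_of_dvd_pow hx.2.1)
  have := Finset.card_le_card h2
  simp at this
  omega

theorem stmt_9 (P Q : ℤ) (hP : P ≠ 0) (hQ : Q ≠ 0) (hD : P ^ 2 - 4 * Q ≠ 0)
    (hnd : ∀ m : ℕ, 1 ≤ m → lucasU P Q m ≠ 0)
    (n : ℕ) (hn : 1 < n) (hnpf : 1 < n.primeFactors.card)
    (hcop : Nat.Coprime n (Int.gcd P Q))
    (p : ℕ) (hp : p.Prime) (hpn : p ∣ n)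
    (hmax : ∀ q : ℕ, q.Prime → q ∣ n → q ≤ p)
    (hexc : ¬ (¬ (2 : ℤ) ∣ P ∧ ¬ (2 : ℤ) ∣ Q ∧ n / 2 ^ (n.factorization 2) = 3)) :
    (((p : ℤ) ∣ lucasU P Q (n / p ^ (n.factorization p)) ∧
        ∀ m : ℕ, 1 ≤ m → m < n / p ^ (n.factorization p) →
          ¬ (p : ℤ) ∣ lucasU P Q m) →
      ∃ t : ℤ, mobiusDualU P Q n
        = (jacobiSym (P ^ 2 - 4 * Q) p : ℚ) * (p : ℚ) + (n : ℚ) * (t : ℚ)) ∧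
    (¬ ((p : ℤ) ∣ lucasU P Q (n / p ^ (n.factorization p)) ∧
        ∀ m : ℕ, 1 ≤ m → m < n / p ^ (n.factorization p) →
          ¬ (p : ℤ) ∣ lucasU P Q m) →
      ∃ t : ℤ, mobiusDualU P Q n = 1 + (n : ℚ) * (t : ℚ)) := by
  have hn0 : n ≠ 0 := by omega
  have hPQ (q : ℕ) (hq : q.Prime) (hqn : q ∣ n) : ¬ ((q : ℤ) ∣ P ∧ (q : ℤ) ∣ Q) := by
    rintro ⟨h1, h2⟩
    have h3 : q ∣ Int.gcd P Q := by exact_mod_cast Int.dvd_coe_gcd h1 h2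
    exact hq.one_lt.ne' (Nat.dvd_one.1 (hcop ▸ Nat.dvd_gcd hqn h3))
  have hm2 (q : ℕ) (hq : q.Prime) := two_le_ordCompl n hn hnpf q hq
  have hm (q : ℕ) (hq : q.Prime) : ¬ q ∣ n / q ^ (n.factorization q) :=
    Nat.not_dvd_ordCompl hq hn0
  have hfac (q : ℕ) (hq : q.Prime) (hqn : q ∣ n) : ∃ c, n.factorization q = c + 1 := by
    have := hq.factorization_pos_of_dvd hn0 hqn
    exact ⟨n.factorization q - 1, by omega⟩
  have hA (q : ℕ) (hq : q.Prime) (hqn : q ∣ n)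
      (hE : ¬ IsEntry P Q q (n / q ^ (n.factorization q))) :
      (q : ℤ) ^ (n.factorization q) ∣ Tv n P Q - 1 := by
    obtain ⟨c, hc⟩ := hfac q hq hqn
    have h := caseA P Q hQ hD q hq _ (hm2 q hq) (hm q hq) (hPQ q hq hqn) hE c
    rwa [← hc, Nat.ordProj_mul_ordCompl_eq_self] at h
  have hne (q : ℕ) (hq : q.Prime) (hqn : q ∣ n) (hqp : q ≠ p) :
      ¬ IsEntry P Q q (n / q ^ (n.factorization q)) := fun hE =>
    hqp (entry_le P Q n hn p hp hpn hmax hexc q hq hqn (hPQ q hq hqn) (hm2 q hq) hE)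
  have hp2 : p ≠ 2 := by
    rintro rfl
    have : n.primeFactors ⊆ {2} := by
      intro q hq
      rw [Nat.mem_primeFactors] at hq
      have h1 := hmax q hq.1 hq.2.1
      have h2 := hq.1.two_le
      rw [Finset.mem_singleton]; omega
    have := Finset.card_le_card this
    simp at this
    omega
  rw [mobius_eq_Tv P Q hD hnd n (by omega)]
  constructor
  · intro hE
    replace hE : IsEntry P Q p (n / p ^ (n.factorization p)) := hE
    obtain ⟨-, -, hε⟩ := entry_facts P Q p hp hp2 _ (hm2 p hp) (hm p hp) (hPQ p hp hpn) hE
    have hmε : ((n / p ^ (n.factorization p) : ℕ) : ℤ) ∣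
        jacobiSym (P ^ 2 - 4 * Q) p * p - 1 := by
      have hp1 := hp.pos
      rcases hε with ⟨h1, h2⟩ | ⟨h1, h2⟩
      · rw [h1, one_mul]
        have := Int.natCast_dvd_natCast.2 h2
        rwa [Nat.cast_sub hp1, Nat.cast_one] at this
      · rw [h1]
        have := Int.natCast_dvd_natCast.2 h2
        rw [Nat.cast_add, Nat.cast_one] at this
        have h3 := (dvd_neg).2 this
        have e : -1 * (p : ℤ) - 1 = -(p + 1) := by ring
        rw [e]; exact h3
    have hdvd : (n : ℤ) ∣ Tv n P Q - jacobiSym (P ^ 2 - 4 * Q) p * p := by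
      refine dvd_of_local n _ (fun q hq hqn => ?_) hn0
      by_cases hqp : q = p
      · subst hqp
        obtain ⟨c, hc⟩ := hfac q hq hqn
        have h := caseB P Q hQ hD hnd q hq hp2 _ (hm2 q hq) (hm q hq) (hPQ q hq hqn) hE c
        rwa [← hc, Nat.ordProj_mul_ordCompl_eq_self] at h
      · have h1 := hA q hq hqn (hne q hq hqn hqp)
        have h2 : q ^ (n.factorization q) ∣ n / p ^ (n.factorization p) := by
          have h3 : q ^ (n.factorization q) ∣ n := Nat.ordProj_dvd n q
          have h4 := Nat.ordProj_mul_ordCompl_eq_self n p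
          conv_rhs at h3 => rw [← h4]
          refine Nat.Coprime.dvd_of_dvd_mul_left ?_ h3
          exact Nat.Coprime.pow _ _ ((Nat.coprime_primes hq hp).2 hqp)
        have h3 := (Int.natCast_dvd_natCast.2 h2).trans hmε
        push_cast at h3
        have h4 := dvd_sub h1 h3
        rwa [sub_sub_sub_cancel_right] at h4
    obtain ⟨t, ht⟩ := hdvd
    refine ⟨t, ?_⟩
    have ht' : Tv n P Q = jacobiSym (P ^ 2 - 4 * Q) p * p + n * t := by linear_combination ht
    exact_mod_cast congrArg (Int.cast : ℤ → ℚ) ht'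
  · intro hE
    replace hE : ¬ IsEntry P Q p (n / p ^ (n.factorization p)) := hE
    have hdvd : (n : ℤ) ∣ Tv n P Q - 1 := by
      refine dvd_of_local n _ (fun q hq hqn => ?_) hn0
      by_cases hqp : q = p
      · subst hqp
        exact hA q hq hqn hE
      · exact hA q hq hqn (hne q hq hqn hqp)
    obtain ⟨t, ht⟩ := hdvd
    refine ⟨t, ?_⟩
    have ht' : Tv n P Q = 1 + n * t := by linear_combination ht
    exact_mod_cast congrArg (Int.cast : ℤ → ℚ) ht'
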